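/- Assume p₁ ≠ p₂. Then f is singular in the sense that its derivative vanishes almost everywhere: for Lebesgue-almost every x ∈ [0,1], f is differentiable at x and f'(x) = 0. -/

import Mathlib

open Filter MeasureTheory Finset

/-- The "beta" values `β₀ = 0`, `β₁ = p₀`, `β₂ = p₀ + p₁` associated with weights `p`. -/
noncomputable def P3beta (p : Fin 3 → ℝ) : Fin 3 → ℝ := ![0, p 0, p 0 + p 1]

/-- The P₃-value of a digit sequence `i : ℕ → Fin 3` (0-indexed):
`val(i) = β_{i₀} + Σ_{k≥1} β_{i_k} ∏_{r<k} p_{i_r}`. -/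
noncomputable def P3val (p : Fin 3 → ℝ) (i : ℕ → Fin 3) : ℝ :=
  ∑' k : ℕ, P3beta p (i k) * ∏ r ∈ Finset.range k, p (i r)

/-- The digit permutation θ with θ(0)=0, θ(1)=2, θ(2)=1. -/
def P3theta : Fin 3 → Fin 3 := ![0, 2, 1]

/-- The one-sided shift on digit sequences. -/
def P3shift (i : ℕ → Fin 3) : ℕ → Fin 3 := fun k => i (k + 1)

open scoped Topology

/-- The length of the rank `n` cylinder with the digits of `i`. -/
noncomputable def cylLength (p : Fin 3 → ℝ) (i : ℕ → Fin 3) (n : ℕ) : ℝ :=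
  ∏ r ∈ Finset.range n, p (i r)

/-- The left endpoint of the rank `n` cylinder with the digits of `i`. -/
noncomputable def cylLeft (p : Fin 3 → ℝ) (i : ℕ → Fin 3) (n : ℕ) : ℝ :=
  ∑ k ∈ Finset.range n, P3beta p (i k) * ∏ r ∈ Finset.range k, p (i r)

/-- The geometric mean of the weight of a digit and the weight of its image under `θ`. -/
noncomputable def geomWeight (p : Fin 3 → ℝ) (t : Fin 3) : ℝ := √(p t * p (P3theta t))

/-- The radius of the excluded neighbourhoods of the endpoints of a rank `n` cylinder. -/
noncomputable def cylMargin (p : Fin 3 → ℝ) (ν : ℝ) (i : ℕ → Fin 3) (n : ℕ) : ℝ :=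
  (ν ^ n)⁻¹ * cylLength (geomWeight p) i n

/-- The digit sequence that continues the finite word `w` with zeros. -/
def extendWord {n : ℕ} (w : Fin n → Fin 3) (k : ℕ) : Fin 3 :=
  if h : k < n then w ⟨k, h⟩ else 0

/-- The points close to an endpoint of some cylinder of rank `n`. -/
def nearEndpoints (p : Fin 3 → ℝ) (ν : ℝ) (n : ℕ) : Set ℝ :=
  ⋃ w : Fin n → Fin 3,
    Metric.ball (cylLeft p (extendWord w) n) (cylMargin p ν (extendWord w) n) ∪
    Metric.ball (cylLeft p (extendWord w) n + cylLength p (extendWord w) n)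
      (cylMargin p ν (extendWord w) n)

lemma cylLength_succ (p : Fin 3 → ℝ) (i : ℕ → Fin 3) (n : ℕ) :
    cylLength p i (n + 1) = cylLength p i n * p (i n) :=
  Finset.prod_range_succ _ _

lemma cylLeft_succ (p : Fin 3 → ℝ) (i : ℕ → Fin 3) (n : ℕ) :
    cylLeft p i (n + 1) = cylLeft p i n + P3beta p (i n) * cylLength p i n :=
  Finset.sum_range_succ _ _

lemma cylLength_pos {p : Fin 3 → ℝ} (hp : ∀ t, 0 < p t) (i : ℕ → Fin 3) (n : ℕ) :
    0 < cylLength p i n :=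
  Finset.prod_pos fun _ _ => hp _

lemma cylLength_congr (p : Fin 3 → ℝ) {i j : ℕ → Fin 3} {n : ℕ} (h : ∀ k < n, i k = j k) :
    cylLength p i n = cylLength p j n :=
  Finset.prod_congr rfl fun k hk => by rw [h k (Finset.mem_range.1 hk)]

lemma cylLeft_congr (p : Fin 3 → ℝ) {i j : ℕ → Fin 3} {n : ℕ} (h : ∀ k < n, i k = j k) :
    cylLeft p i n = cylLeft p j n := by
  refine Finset.sum_congr rfl fun k hk => ?_
  have hk := Finset.mem_range.1 hk
  rw [h k hk]
  exact congrArg _ (cylLength_congr p fun r hr => h r (hr.trans hk))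

lemma cylLength_extendWord (p : Fin 3 → ℝ) {n : ℕ} (w : Fin n → Fin 3) :
    cylLength p (extendWord w) n = ∏ k, p (w k) := by
  simp [cylLength, Finset.prod_range, extendWord]

lemma cylLength_geomWeight_sq {p : Fin 3 → ℝ} (hp : ∀ t, 0 < p t) (i : ℕ → Fin 3) (n : ℕ) :
    cylLength (geomWeight p) i n ^ 2 =
      cylLength p i n * cylLength p (fun k => P3theta (i k)) n := by
  simp only [cylLength, ← Finset.prod_pow, ← Finset.prod_mul_distrib]
  exact Finset.prod_congr rfl fun k _ => Real.sq_sqrt (mul_pos (hp _) (hp _)).le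

lemma P3beta_nonneg {p : Fin 3 → ℝ} (hp : ∀ t, 0 < p t) (t : Fin 3) : 0 ≤ P3beta p t := by
  have h0 := hp 0
  have h1 := hp 1
  fin_cases t <;> simp [P3beta] <;> linarith

lemma P3beta_add_le_one {p : Fin 3 → ℝ} (hp : ∀ t, 0 < p t) (hsum : p 0 + p 1 + p 2 = 1)
    (t : Fin 3) : P3beta p t + p t ≤ 1 := by
  have h1 := hp 1
  have h2 := hp 2
  fin_cases t <;> simp [P3beta] <;> linarith

lemma P3beta_add_le_of_lt {p : Fin 3 → ℝ} (hp : ∀ t, 0 < p t) {s t : Fin 3} (h : s < t) :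
    P3beta p s + p s ≤ P3beta p t := by
  have h1 := (hp 1).le
  fin_cases s <;> fin_cases t <;> simp_all [P3beta]

lemma cylLeft_mono {p : Fin 3 → ℝ} (hp : ∀ t, 0 < p t) (i : ℕ → Fin 3) :
    Monotone (cylLeft p i) :=
  monotone_nat_of_le_succ fun n => by
    rw [cylLeft_succ]
    linarith [mul_nonneg (P3beta_nonneg hp (i n)) (cylLength_pos hp i n).le]

lemma cylRight_antitone {p : Fin 3 → ℝ} (hp : ∀ t, 0 < p t) (hsum : p 0 + p 1 + p 2 = 1)
    (i : ℕ → Fin 3) : Antitone fun n => cylLeft p i n + cylLength p i n :=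
  antitone_nat_of_succ_le fun n => by
    rw [cylLeft_succ, cylLength_succ]
    nlinarith [P3beta_add_le_one hp hsum (i n), cylLength_pos hp i n]

lemma tendsto_cylLeft {p : Fin 3 → ℝ} (hp : ∀ t, 0 < p t) (hsum : p 0 + p 1 + p 2 = 1)
    (i : ℕ → Fin 3) : Tendsto (cylLeft p i) atTop (𝓝 (P3val p i)) := by
  refine (summable_of_sum_range_le (c := 1) (fun k => ?_) fun n => ?_).hasSum.tendsto_sum_nat
  · exact mul_nonneg (P3beta_nonneg hp _) (cylLength_pos hp i k).le
  · have h := cylRight_antitone hp hsum i (Nat.zero_le n)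
    have h' := cylLength_pos hp i n
    change cylLeft p i n ≤ 1
    simp only [cylLeft, cylLength, Finset.sum_range_zero, Finset.prod_range_zero] at h h' ⊢
    linarith

lemma cylLeft_le_P3val {p : Fin 3 → ℝ} (hp : ∀ t, 0 < p t) (hsum : p 0 + p 1 + p 2 = 1)
    (i : ℕ → Fin 3) (n : ℕ) : cylLeft p i n ≤ P3val p i :=
  (cylLeft_mono hp i).ge_of_tendsto (tendsto_cylLeft hp hsum i) n

lemma P3val_le_cylRight {p : Fin 3 → ℝ} (hp : ∀ t, 0 < p t) (hsum : p 0 + p 1 + p 2 = 1)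
    (i : ℕ → Fin 3) (n : ℕ) : P3val p i ≤ cylLeft p i n + cylLength p i n :=
  le_of_tendsto (tendsto_cylLeft hp hsum i) <| by
    filter_upwards [eventually_ge_atTop n] with m hm
    have h : cylLeft p i m + cylLength p i m ≤ cylLeft p i n + cylLength p i n :=
      cylRight_antitone hp hsum i hm
    linarith [cylLength_pos hp i m]

lemma abs_P3val_sub_le {p : Fin 3 → ℝ} (hp : ∀ t, 0 < p t) (hsum : p 0 + p 1 + p 2 = 1)
    {i j : ℕ → Fin 3} {n : ℕ} (h : ∀ k < n, i k = j k) :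
    |P3val p j - P3val p i| ≤ cylLength p i n := by
  have hi := cylLeft_le_P3val hp hsum i n
  have hi' := P3val_le_cylRight hp hsum i n
  have hj := cylLeft_le_P3val hp hsum j n
  have hj' := P3val_le_cylRight hp hsum j n
  rw [← cylLeft_congr p h] at hj hj'
  rw [← cylLength_congr p h] at hj'
  rw [abs_le]
  constructor <;> linarith

/-- A point whose digits leave those of `i` at position `m` is not interior to the cylinders
of `i` of rank greater than `m`. -/
lemma P3val_notMem_interior {p : Fin 3 → ℝ} (hp : ∀ t, 0 < p t) (hsum : p 0 + p 1 + p 2 = 1)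
    {i j : ℕ → Fin 3} {m n : ℕ} (h : ∀ k < m, i k = j k) (hm : i m ≠ j m) (hmn : m < n) :
    P3val p j ∉ Set.Ioo (cylLeft p i n) (cylLeft p i n + cylLength p i n) := by
  rintro ⟨h1, h2⟩
  have hl := cylLeft_mono hp i hmn
  have hr : cylLeft p i n + cylLength p i n ≤ cylLeft p i (m + 1) + cylLength p i (m + 1) :=
    cylRight_antitone hp hsum i hmn
  have hj := cylLeft_le_P3val hp hsum j (m + 1)
  have hj' := P3val_le_cylRight hp hsum j (m + 1)
  have hpos := cylLength_pos hp i m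
  simp only [Nat.succ_eq_add_one, cylLeft_succ, cylLength_succ] at hl hr hj hj'
  rw [← cylLeft_congr p h, ← cylLength_congr p h] at hj hj'
  rcases lt_or_gt_of_ne hm with hlt | hlt
  · nlinarith [P3beta_add_le_of_lt hp hlt]
  · nlinarith [P3beta_add_le_of_lt hp hlt]

lemma geomWeight_pos {p : Fin 3 → ℝ} (hp : ∀ t, 0 < p t) (t : Fin 3) : 0 < geomWeight p t :=
  Real.sqrt_pos.2 (mul_pos (hp _) (hp _))

lemma sum_geomWeight_lt_one {p : Fin 3 → ℝ} (hp : ∀ t, 0 < p t) (hsum : p 0 + p 1 + p 2 = 1)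
    (h12 : p 1 ≠ p 2) : ∑ t, geomWeight p t < 1 := by
  have h : √(p 1 * p 2) < (p 1 + p 2) / 2 := by
    rw [Real.sqrt_lt' (by linarith [hp 1, hp 2])]
    nlinarith [sq_pos_of_ne_zero (sub_ne_zero.2 h12)]
  simp only [Fin.sum_univ_three, geomWeight, P3theta, Matrix.cons_val, mul_comm (p 2) (p 1),
    Real.sqrt_mul_self (hp 0).le]
  linarith

lemma cylMargin_pos {p : Fin 3 → ℝ} (hp : ∀ t, 0 < p t) {ν : ℝ} (hν : 0 < ν) (i : ℕ → Fin 3)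
    (n : ℕ) : 0 < cylMargin p ν i n :=
  mul_pos (inv_pos.2 (pow_pos hν n)) (cylLength_pos (geomWeight_pos hp) i n)

lemma volume_nearEndpoints_le (p : Fin 3 → ℝ) {ν : ℝ} (hν : 0 < ν) (n : ℕ) :
    volume (nearEndpoints p ν n) ≤ ENNReal.ofReal (4 * ((∑ t, geomWeight p t) / ν) ^ n) := by
  have hnonneg (w : Fin n → Fin 3) : 0 ≤ cylMargin p ν (extendWord w) n :=
    mul_nonneg (inv_nonneg.2 (pow_nonneg hν.le n))
      (Finset.prod_nonneg fun _ _ => Real.sqrt_nonneg _)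
  calc volume (nearEndpoints p ν n)
      ≤ ∑ w : Fin n → Fin 3, ENNReal.ofReal (4 * cylMargin p ν (extendWord w) n) := by
        refine (measure_iUnion_fintype_le _ _).trans (Finset.sum_le_sum fun w _ => ?_)
        refine (measure_union_le _ _).trans_eq ?_
        rw [Real.volume_ball, Real.volume_ball, ← ENNReal.ofReal_add
          (by linarith [hnonneg w]) (by linarith [hnonneg w])]
        ring_nf
    _ = ENNReal.ofReal (4 * ((∑ t, geomWeight p t) / ν) ^ n) := by
        rw [← ENNReal.ofReal_sum_of_nonneg fun w _ => by linarith [hnonneg w]]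
        congr 1
        simp only [cylMargin, cylLength_extendWord, ← Finset.mul_sum, ← Fintype.sum_pow, div_pow]
        ring

lemma ae_eventually_notMem_nearEndpoints (p : Fin 3 → ℝ) {ν : ℝ} (hν : 0 < ν)
    (h : ∑ t, geomWeight p t < ν) : ∀ᵐ x, ∀ᶠ n in atTop, x ∉ nearEndpoints p ν n := by
  refine ae_eventually_notMem (ne_top_of_le_ne_top ?_
    (ENNReal.tsum_le_tsum fun n => volume_nearEndpoints_le p hν n))
  refine Summable.tsum_ofReal_ne_top (Summable.mul_left _ (summable_geometric_of_lt_one ?_ ?_))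
  · exact div_nonneg (Finset.sum_nonneg fun _ _ => Real.sqrt_nonneg _) hν.le
  · rwa [div_lt_one hν]

/-- Outside `nearEndpoints`, the point keeps the distance `cylMargin` from both endpoints of
its cylinder. -/
lemma cylMargin_le_of_notMem {p : Fin 3 → ℝ} (hp : ∀ t, 0 < p t) (hsum : p 0 + p 1 + p 2 = 1)
    {ν : ℝ} {i : ℕ → Fin 3} {n : ℕ} (h : P3val p i ∉ nearEndpoints p ν n) :
    cylLeft p i n + cylMargin p ν i n ≤ P3val p i ∧
      P3val p i + cylMargin p ν i n ≤ cylLeft p i n + cylLength p i n := by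
  have hw : ∀ k < n, extendWord (fun k : Fin n => i k) k = i k := fun k hk => by
    simp [extendWord, hk]
  simp only [nearEndpoints, Set.mem_iUnion, not_exists, Set.mem_union, not_or, Metric.mem_ball,
    not_lt] at h
  obtain ⟨h1, h2⟩ := h fun k => i k
  rw [cylMargin, cylLength_congr _ hw, cylLeft_congr _ hw, Real.dist_eq] at h1 h2
  rw [cylLength_congr _ hw] at h2
  rw [abs_of_nonneg (by linarith [cylLeft_le_P3val hp hsum i n])] at h1
  rw [abs_of_nonpos (by linarith [P3val_le_cylRight hp hsum i n])] at h2
  rw [cylMargin]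
  constructor <;> linarith

lemma cylLength_theta_le {p : Fin 3 → ℝ} (hp : ∀ t, 0 < p t) {ν : ℝ} (hν : 0 < ν)
    {i : ℕ → Fin 3} {n : ℕ} (h : cylMargin p ν i n ≤ cylLength p i n) :
    cylLength p (fun k => P3theta (i k)) n ≤ (ν ^ 2) ^ n * cylMargin p ν i n := by
  have hm := cylMargin_pos hp hν i n
  have hQ := cylLength_pos hp (fun k => P3theta (i k)) n
  have hsq : (ν ^ 2) ^ n * cylMargin p ν i n * cylMargin p ν i n =
      cylLength p i n * cylLength p (fun k => P3theta (i k)) n := by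
    rw [← cylLength_geomWeight_sq hp, cylMargin]
    field_simp
    ring
  refine le_of_mul_le_mul_right ?_ hm
  rw [hsq, mul_comm]
  exact mul_le_mul_of_nonneg_right h hQ.le

lemma abs_P3val_theta_sub_le {p : Fin 3 → ℝ} (hp : ∀ t, 0 < p t) (hsum : p 0 + p 1 + p 2 = 1)
    {ν c : ℝ} (hν : 0 < ν) (hc : 0 < c) (hcp : ∀ t, c ≤ p t) {i j : ℕ → Fin 3} {m : ℕ}
    (h : ∀ k < m, i k = j k) (hm : i m ≠ j m) (hi : P3val p i ∉ nearEndpoints p ν (m + 1)) :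
    |P3val p (fun k => P3theta (j k)) - P3val p (fun k => P3theta (i k))| ≤
      c⁻¹ * (ν ^ 2) ^ (m + 1) * |P3val p j - P3val p i| := by
  obtain ⟨h1, h2⟩ := cylMargin_le_of_notMem hp hsum hi
  have hpos := cylMargin_pos hp hν i (m + 1)
  have hQ := cylLength_pos hp (fun k => P3theta (i k)) m
  have hfar : cylMargin p ν i (m + 1) ≤ |P3val p j - P3val p i| := by
    by_contra! hlt
    rw [abs_lt] at hlt
    exact P3val_notMem_interior hp hsum h hm m.lt_succ_self
      ⟨by linarith [hlt.1], by linarith [hlt.2]⟩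
  calc |P3val p (fun k => P3theta (j k)) - P3val p (fun k => P3theta (i k))|
      ≤ cylLength p (fun k => P3theta (i k)) m :=
        abs_P3val_sub_le hp hsum fun k hk => congrArg P3theta (h k hk)
    _ ≤ c⁻¹ * cylLength p (fun k => P3theta (i k)) (m + 1) := by
        rw [cylLength_succ, ← div_eq_inv_mul, le_div_iff₀ hc]
        exact mul_le_mul_of_nonneg_left (hcp _) hQ.le
    _ ≤ c⁻¹ * ((ν ^ 2) ^ (m + 1) * cylMargin p ν i (m + 1)) := by
        gcongr
        exact cylLength_theta_le hp hν (by linarith)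
    _ ≤ c⁻¹ * (ν ^ 2) ^ (m + 1) * |P3val p j - P3val p i| := by
        rw [← mul_assoc]
        gcongr

theorem stmt18 (p : Fin 3 → ℝ) (hp : ∀ t, p t ∈ Set.Ioo (0 : ℝ) 1)
    (hsum : p 0 + p 1 + p 2 = 1)
    (h12 : p 1 ≠ p 2)
    (f : ℝ → ℝ)
    (hf : ∀ i : ℕ → Fin 3, (¬ ∃ N, ∀ k ≥ N, i k = 2) →
      f (P3val p i) = P3val p (fun k => P3theta (i k)))
    (hrep : ∀ x ∈ Set.Ico (0 : ℝ) 1, ∃ i : ℕ → Fin 3,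
      (¬ ∃ N, ∀ k ≥ N, i k = 2) ∧ P3val p i = x) :
    ∀ᵐ x ∂(volume.restrict (Set.Icc (0 : ℝ) 1)), HasDerivAt f 0 x := by
  have hpos : ∀ t, 0 < p t := fun t => (hp t).1
  obtain ⟨ν, hqν, hν1⟩ := exists_between (sum_geomWeight_lt_one hpos hsum h12)
  have hν : 0 < ν := (Finset.sum_nonneg fun _ _ => Real.sqrt_nonneg _).trans_lt hqν
  obtain ⟨t₀, ht₀⟩ := Finite.exists_min p
  rw [ae_restrict_iff' measurableSet_Icc]
  filter_upwards [ae_eventually_notMem_nearEndpoints p hν hqν, (measure_eq_zero_iff_ae_notMem.1 (measure_singleton (1 : ℝ)))]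
    with x hx hx1 hx01
  obtain ⟨i, hi2, rfl⟩ := hrep x ⟨hx01.1, hx01.2.lt_of_ne hx1⟩
  rw [hasDerivAt_iff_isLittleO, Asymptotics.isLittleO_iff]
  intro ε hε
  have hlim : Tendsto (fun n : ℕ => (p t₀)⁻¹ * (ν ^ 2) ^ n) atTop (𝓝 0) := by
    simpa using (tendsto_pow_atTop_nhds_zero_of_lt_one (sq_nonneg ν)
      (pow_lt_one₀ hν.le hν1 two_ne_zero)).const_mul (p t₀)⁻¹
  obtain ⟨N, hN⟩ := eventually_atTop.1 (hx.and (hlim.eventually_lt_const hε))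
  obtain ⟨h1, h2⟩ := cylMargin_le_of_notMem hpos hsum (hN N le_rfl).1
  have hmargin := cylMargin_pos hpos hν i N
  filter_upwards [Ioo_mem_nhds (show cylLeft p i N < P3val p i by linarith)
    (show P3val p i < cylLeft p i N + cylLength p i N by linarith)] with y hy
  have hy0 : cylLeft p i 0 ≤ cylLeft p i N := cylLeft_mono hpos i N.zero_le
  have hy1 : cylLeft p i N + cylLength p i N ≤ cylLeft p i 0 + cylLength p i 0 :=
    cylRight_antitone hpos hsum i N.zero_le
  simp only [cylLeft, cylLength, Finset.sum_range_zero, Finset.prod_range_zero] at hy0 hy1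
  obtain ⟨j, hj2, rfl⟩ := hrep y ⟨hy0.trans hy.1.le, by simpa using hy.2.trans_le hy1⟩
  rw [hf i hi2, hf j hj2, smul_zero, sub_zero, Real.norm_eq_abs, Real.norm_eq_abs]
  by_cases hij : i = j
  · simp [hij]
  have hex : ∃ m, i m ≠ j m := Function.ne_iff.1 hij
  classical
  have hmin : ∀ k < Nat.find hex, i k = j k := fun k hk => not_not.1 (Nat.find_min hex hk)
  have hNm : N ≤ Nat.find hex := not_lt.1 fun hlt =>
    P3val_notMem_interior hpos hsum hmin (Nat.find_spec hex) hlt hy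
  obtain ⟨hn, hsmall⟩ := hN (Nat.find hex + 1) (by lia)
  exact (abs_P3val_theta_sub_le hpos hsum hν (hpos t₀) ht₀ hmin (Nat.find_spec hex) hn).trans
    (mul_le_mul_of_nonneg_right hsmall.le (abs_nonneg _))
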